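/- Each job in B1 ∪ B2 is d-tight, i.e., Σ_{h∈M} y_{jh} = w for every job j with x_{j1} non-integer or x_{j2} non-integer. -/

import Mathlib

open Finset

noncomputable section

/-- Feasibility for system `S`. -/
def FeasibleS {J M : Type*} [Fintype J] [Fintype M]
    (G1 G2 : Finset M) (b : J → M → ℕ) (a1 a2 : J → ℕ)
    (y : J → M → ℝ) (x1 x2 : J → ℝ) (r w : ℝ) : Prop :=
  (∀ h ∈ G1, ((∑ j, (b j h : ℝ)) - ((∑ j, (a2 j : ℝ)) - r) ≤ (∑ j, y j h)) ∧
    ((∑ j, y j h) ≤ w)) ∧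
  (∀ h ∈ G2, ((∑ j, (b j h : ℝ)) - ((∑ j, (a1 j : ℝ)) - r) ≤ (∑ j, y j h)) ∧
    ((∑ j, y j h) ≤ w)) ∧
  (∀ j, (∑ h, y j h) ≤ w) ∧
  (∀ j, ∀ h, 0 ≤ y j h ∧ y j h ≤ (b j h : ℝ)) ∧
  ((∑ j, x1 j) = r) ∧ ((∑ j, x2 j) = r) ∧
  (∀ j, x1 j + x2 j ≤ r) ∧
  (∀ j, 0 ≤ x1 j ∧ x1 j ≤ (a1 j : ℝ)) ∧
  (∀ j, 0 ≤ x2 j ∧ x2 j ≤ (a2 j : ℝ)) ∧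
  (∀ j, (∑ h ∈ G1, ((b j h : ℝ) - y j h)) + (a2 j : ℝ) - x2 j ≤ (∑ j', (a2 j' : ℝ)) - r) ∧
  (∀ j, (∑ h ∈ G2, ((b j h : ℝ) - y j h)) + (a1 j : ℝ) - x1 j ≤ (∑ j', (a1 j' : ℝ)) - r)

/-- Feasibility for the linear program `ℓp` associated with an optimal
LP-relaxation value `(rstar, wstar)`. -/
def FeasibleLP {J M : Type*} [Fintype J] [Fintype M]
    (G1 G2 : Finset M) (b : J → M → ℕ) (a1 a2 : J → ℕ)
    (rstar wstar : ℝ)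
    (y : J → M → ℝ) (x1 x2 : J → ℝ) (r w : ℝ) : Prop :=
  FeasibleS G1 G2 b a1 a2 y x1 x2 r w ∧
  w - r = (⌈wstar - rstar⌉ : ℝ) ∧ ((⌊rstar⌋ : ℝ) ≤ r)

theorem farkas_aux {V : Type*} [AddCommGroup V] [Module ℝ V] {ι : Type*} [DecidableEq ι]
    (s : Finset ι) : ∀ (l : ι → V →ₗ[ℝ] ℝ) (φ : V →ₗ[ℝ] ℝ),
    (∀ v, (∀ i ∈ s, 0 ≤ l i v) → 0 ≤ φ v) →
    ∃ c : ι → ℝ, (∀ i, 0 ≤ c i) ∧ ∀ v, φ v = ∑ i ∈ s, c i * l i v := by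
  induction s using Finset.induction_on with
  | empty =>
    intro l φ H
    refine ⟨fun _ => 0, fun _ => le_rfl, fun v => ?_⟩
    have h1 := H v (by simp)
    have h2 := H (-v) (by simp)
    rw [map_neg] at h2
    simp; linarith
  | insert i0 s hi0 ih =>
    intro l φ H
    by_cases h : ∀ v, (∀ i ∈ s, 0 ≤ l i v) → 0 ≤ φ v
    · obtain ⟨c, hc0, hc⟩ := ih l φ h
      refine ⟨fun i => if i = i0 then 0 else c i, fun i => ?_, fun v => ?_⟩
      · dsimp only; split_ifs
        · exact le_rfl
        · exact hc0 i
      · rw [Finset.sum_insert hi0, hc v]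
        simp only [if_true, zero_mul, zero_add]
        refine Finset.sum_congr rfl fun i hi => ?_
        rw [if_neg]
        rintro rfl; exact hi0 hi
    · push Not at h
      obtain ⟨v1, hv1, hφ1⟩ := h
      have hneg : l i0 v1 < 0 := by
        by_contra hcon
        push Not at hcon
        have := H v1 (by
          intro i hi
          rcases Finset.mem_insert.mp hi with rfl | hi
          · exact hcon
          · exact hv1 i hi)
        linarith
      set v0 : V := (-(l i0 v1))⁻¹ • v1 with hv0
      have hpos : 0 < (-(l i0 v1))⁻¹ := inv_pos.mpr (by linarith)
      have hl0 : l i0 v0 = -1 := by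
        rw [hv0, map_smul, smul_eq_mul, inv_neg, neg_mul, inv_mul_cancel₀ hneg.ne]
      have hv0s : ∀ i ∈ s, 0 ≤ l i v0 := by
        intro i hi
        rw [hv0, map_smul, smul_eq_mul]
        exact mul_nonneg hpos.le (hv1 i hi)
      have hφ0 : φ v0 < 0 := by
        rw [hv0, map_smul, smul_eq_mul]
        exact mul_neg_of_pos_of_neg hpos hφ1
      obtain ⟨c, hc0, hc⟩ := ih (fun i => l i + (l i v0) • l i0) (φ + (φ v0) • l i0) (by
        intro v hv
        have := H (v + (l i0 v) • v0) (by
          intro i hi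
          rcases Finset.mem_insert.mp hi with rfl | hi
          · simp [hl0]
          · have := hv i hi
            simp only [LinearMap.add_apply, LinearMap.smul_apply, smul_eq_mul] at this
            simp only [map_add, map_smul, smul_eq_mul]
            linarith)
        simp only [map_add, map_smul, smul_eq_mul] at this
        simp only [LinearMap.add_apply, LinearMap.smul_apply, smul_eq_mul]
        linarith)
      refine ⟨fun i => if i = i0 then (∑ i ∈ s, c i * l i v0) - φ v0 else c i,
        fun i => ?_, fun v => ?_⟩
      · dsimp only; split_ifs
        · have := Finset.sum_nonneg (fun i hi => mul_nonneg (hc0 i) (hv0s i hi))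
          linarith
        · exact hc0 i
      · have := hc v
        simp only [LinearMap.add_apply, LinearMap.smul_apply, smul_eq_mul] at this
        rw [Finset.sum_insert hi0]
        simp only [if_true]
        have h2 : ∑ i ∈ s, (if i = i0 then (∑ i ∈ s, c i * l i v0) - φ v0 else c i) * l i v
            = ∑ i ∈ s, c i * l i v := by
          refine Finset.sum_congr rfl fun i hi => ?_
          rw [if_neg]
          rintro rfl; exact hi0 hi
        rw [h2]
        have h3 : ∑ i ∈ s, c i * (l i v + l i v0 * l i0 v)
            = ∑ i ∈ s, c i * l i v + (∑ i ∈ s, c i * l i v0) * l i0 v := by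
          rw [Finset.sum_mul, ← Finset.sum_add_distrib]
          exact Finset.sum_congr rfl fun i _ => by ring
        rw [h3] at this
        linarith

/-- The sawtooth function. -/
def saw (ε θ : ℝ) : ℝ := min (Int.fract θ / ε) ((1 - Int.fract θ) / (1 - ε))

theorem saw_le_one {ε : ℝ} (h0 : 0 < ε) (h1 : ε < 1) (θ : ℝ) : saw ε θ ≤ 1 := by
  unfold saw
  rcases le_total (Int.fract θ) ε with h | h
  · exact (min_le_left _ _).trans ((div_le_one h0).mpr h)
  · exact (min_le_right _ _).trans ((div_le_one (by linarith)).mpr (by linarith))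

theorem saw_nonneg {ε : ℝ} (h0 : 0 < ε) (h1 : ε < 1) (θ : ℝ) : 0 ≤ saw ε θ :=
  le_min (div_nonneg (Int.fract_nonneg _) h0.le)
    (div_nonneg (by linarith [Int.fract_lt_one θ]) (by linarith))

theorem saw_zero {ε : ℝ} (h1 : ε < 1) : saw ε 0 = 0 := by
  unfold saw
  simp only [Int.fract_zero, zero_div, sub_zero]
  exact min_eq_left (div_nonneg zero_le_one (by linarith))

theorem saw_add_int (ε θ : ℝ) (k : ℤ) : saw ε (θ + k) = saw ε θ := by
  unfold saw; rw [Int.fract_add_intCast]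

theorem saw_eps {ε : ℝ} (h0 : 0 < ε) (h1 : ε < 1) : saw ε ε = 1 := by
  unfold saw
  rw [Int.fract_eq_self.mpr ⟨h0.le, h1⟩, div_self h0.ne', div_self (by linarith), min_self]

theorem fract_add_cases (θ φ : ℝ) :
    Int.fract (θ + φ) = Int.fract θ + Int.fract φ ∨
    Int.fract (θ + φ) = Int.fract θ + Int.fract φ - 1 := by
  rcases lt_or_ge (Int.fract θ + Int.fract φ) 1 with h | h
  · left
    rw [Int.fract_eq_iff]
    refine ⟨add_nonneg (Int.fract_nonneg _) (Int.fract_nonneg _), h, ⌊θ⌋ + ⌊φ⌋, ?_⟩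
    have := Int.floor_add_fract θ
    have := Int.floor_add_fract φ
    push_cast; linarith
  · right
    rw [Int.fract_eq_iff]
    refine ⟨by linarith, by linarith [Int.fract_lt_one θ, Int.fract_lt_one φ], ⌊θ⌋ + ⌊φ⌋ + 1, ?_⟩
    have := Int.floor_add_fract θ
    have := Int.floor_add_fract φ
    push_cast; linarith

theorem saw_subadd {ε : ℝ} (h0 : 0 < ε) (h1 : ε < 1) (θ φ : ℝ) :
    saw ε (θ + φ) ≤ saw ε θ + saw ε φ := by
  have hu0 := Int.fract_nonneg θ
  have hv0 := Int.fract_nonneg φ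
  have hu1 := Int.fract_lt_one θ
  have hv1 := Int.fract_lt_one φ
  have h3 : 0 < 1 - ε := by linarith
  have hc := fract_add_cases θ φ
  unfold saw
  generalize Int.fract θ = u at *
  generalize Int.fract φ = v at *
  generalize Int.fract (θ + φ) = s at *
  have d1 : ∀ t t', t ≤ t' → t / ε ≤ t' / ε := fun t t' h => by gcongr
  have d2 : ∀ t t', t ≤ t' → t / (1 - ε) ≤ t' / (1 - ε) := fun t t' h => by gcongr
  have e1 : ∀ t, 0 ≤ t → 0 ≤ t / ε := fun t h => div_nonneg h h0.le
  have e2 : ∀ t, 0 ≤ t → 0 ≤ t / (1 - ε) := fun t h => div_nonneg h h3.le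
  rcases min_choice (u / ε) ((1 - u) / (1 - ε)) with a | a <;>
  rcases min_choice (v / ε) ((1 - v) / (1 - ε)) with c | c <;> rw [a, c] <;>
  rcases hc with rfl | rfl
  · refine (min_le_left _ _).trans ?_
    rw [add_div]
  · refine (min_le_left _ _).trans ?_
    rw [← add_div]; exact d1 _ _ (by linarith)
  · refine (min_le_right _ _).trans ?_
    have := d2 (1 - (u + v)) (1 - v) (by linarith)
    have := e1 u hu0
    linarith
  · refine (min_le_left _ _).trans ?_
    have := d1 (u + v - 1) u (by linarith)
    have := e2 (1 - v) (by linarith)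
    linarith
  · refine (min_le_right _ _).trans ?_
    have := d2 (1 - (u + v)) (1 - u) (by linarith)
    have := e1 v hv0
    linarith
  · refine (min_le_left _ _).trans ?_
    have := d1 (u + v - 1) v (by linarith)
    have := e2 (1 - u) (by linarith)
    linarith
  · refine (min_le_right _ _).trans ?_
    rw [← add_div]; exact d2 _ _ (by linarith)
  · refine (min_le_right _ _).trans ?_
    rw [← add_div]; exact d2 _ _ (by linarith)

theorem saw_pair {ε : ℝ} (h0 : 0 < ε) (h1 : ε < 1) (α β : ℝ) (k : ℤ) (h : α + β = ε + k) :
    saw ε α + saw ε β ≤ 1 := by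
  have hf : Int.fract (α + β) = ε := by
    rw [h, Int.fract_add_intCast, Int.fract_eq_self.mpr ⟨h0.le, h1⟩]
  have h3 : 0 < 1 - ε := by linarith
  unfold saw
  rcases fract_add_cases α β with hc | hc
  · calc _ ≤ Int.fract α / ε + Int.fract β / ε := add_le_add (min_le_left _ _) (min_le_left _ _)
      _ = 1 := by rw [← add_div, ← hc, hf, div_self h0.ne']
  · calc _ ≤ (1 - Int.fract α) / (1 - ε) + (1 - Int.fract β) / (1 - ε) :=
          add_le_add (min_le_right _ _) (min_le_right _ _)
      _ = 1 := by
        rw [← add_div, div_eq_one_iff_eq h3.ne']; linarith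

theorem saw_step {ε : ℝ} (h0 : 0 < ε) (h1 : ε < 1) (θ θ' η η' : ℝ) (g k : ℤ) (hg : 1 ≤ g)
    (h : (θ' - θ) + (η' - η) = g * ε + k) :
    saw ε θ' - saw ε θ + (saw ε η' - saw ε η) ≤ g := by
  rcases eq_or_lt_of_le hg with rfl | hg
  · have a := saw_subadd h0 h1 θ (θ' - θ)
    have c := saw_subadd h0 h1 η (η' - η)
    rw [add_sub_cancel] at a c
    have := saw_pair h0 h1 (θ' - θ) (η' - η) k (by rw [h]; push_cast; ring)
    push_cast; linarith
  · have : (2 : ℝ) ≤ g := by exact_mod_cast hg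
    linarith [saw_le_one h0 h1 θ', saw_le_one h0 h1 η', saw_nonneg h0 h1 θ, saw_nonneg h0 h1 η]

theorem fill_aux {J : Type*} [Fintype J] [DecidableEq J] (p q a : J → ℝ) (r : ℝ)
    (hp0 : ∀ i, 0 ≤ p i) (hpa : ∀ i, p i ≤ a i) (hq0 : ∀ i, 0 ≤ q i)
    (hpq : ∀ i, p i + q i ≤ r) (hsp : ∑ i, p i ≤ r) (hsq : ∑ i, q i ≤ r)
    (hsa : r ≤ ∑ i, a i) (hgap : ∀ t, a t - p t ≤ ∑ i, a i - r) :
    ∃ p' : J → ℝ, (∀ i, p i ≤ p' i) ∧ (∀ i, p' i ≤ a i) ∧ (∀ i, p' i + q i ≤ r) ∧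
      ∑ i, p' i = r := by
  set cap : J → ℝ := fun i => min (a i) (r - q i) with hcap
  have hpc : ∀ i, p i ≤ cap i := fun i => le_min (hpa i) (by linarith [hpq i])
  have hc0 : ∀ i, 0 ≤ cap i := fun i => (hp0 i).trans (hpc i)
  have hsc : r ≤ ∑ i, cap i := by
    by_cases h : ∃ t, r - q t < a t
    · obtain ⟨t, ht⟩ := h
      have hct : cap t = r - q t := min_eq_right ht.le
      by_cases h2 : ∃ s, s ≠ t ∧ r - q s < a s
      · obtain ⟨s, hst, hs⟩ := h2
        have hcs : cap s = r - q s := min_eq_right hs.le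
        have e1 : ∑ i ∈ ({s, t} : Finset J), cap i ≤ ∑ i, cap i :=
          Finset.sum_le_sum_of_subset_of_nonneg (Finset.subset_univ _) (fun i _ _ => hc0 i)
        have e2 : ∑ i ∈ ({s, t} : Finset J), q i ≤ ∑ i, q i :=
          Finset.sum_le_sum_of_subset_of_nonneg (Finset.subset_univ _) (fun i _ _ => hq0 i)
        rw [Finset.sum_pair hst] at e1 e2
        linarith
      · push Not at h2
        rw [← Finset.add_sum_erase _ _ (Finset.mem_univ t)]
        have e1 : ∑ i ∈ Finset.univ.erase t, cap i = ∑ i ∈ Finset.univ.erase t, a i :=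
          Finset.sum_congr rfl fun i hi => min_eq_left (h2 i (Finset.ne_of_mem_erase hi))
        have e2 := Finset.add_sum_erase Finset.univ a (Finset.mem_univ t)
        have := hgap t
        have := hpq t
        linarith
    · push Not at h
      have : ∑ i, cap i = ∑ i, a i := Finset.sum_congr rfl fun i _ => min_eq_left (h i)
      linarith
  rcases eq_or_lt_of_le (hsp.trans hsc) with he | hlt
  · exact ⟨p, fun i => le_rfl, hpa, hpq, by linarith⟩
  · set th := (r - ∑ i, p i) / (∑ i, cap i - ∑ i, p i) with hth
    have hd : 0 < ∑ i, cap i - ∑ i, p i := by linarith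
    have t0 : 0 ≤ th := div_nonneg (by linarith) hd.le
    have t1 : th ≤ 1 := (div_le_one hd).mpr (by linarith)
    have hle : ∀ i, p i + th * (cap i - p i) ≤ cap i := fun i => by
      nlinarith [hpc i]
    refine ⟨fun i => p i + th * (cap i - p i), fun i => ?_, fun i => ?_, fun i => ?_, ?_⟩
    · have := mul_nonneg t0 (sub_nonneg.mpr (hpc i)); linarith
    · exact (hle i).trans (min_le_left _ _)
    · have := (hle i).trans (min_le_right _ _); dsimp only; linarith
    · rw [Finset.sum_add_distrib, ← Finset.mul_sum, Finset.sum_sub_distrib, hth,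
        div_mul_cancel₀ _ hd.ne']
      ring

theorem sum_cover {M : Type*} [Fintype M] [DecidableEq M] {G1 G2 : Finset M}
    (hdisj : Disjoint G1 G2) (hcover : G1 ∪ G2 = Finset.univ) (f : M → ℝ) :
    ∑ h, f h = ∑ h ∈ G1, f h + ∑ h ∈ G2, f h := by
  rw [← hcover, Finset.sum_union hdisj]

theorem repair {J M : Type*} [Fintype J] [Fintype M] [DecidableEq J] [DecidableEq M]
    (G1 G2 : Finset M) (hdisj : Disjoint G1 G2) (hcover : G1 ∪ G2 = Finset.univ)
    (b : J → M → ℕ) (a1 a2 : J → ℕ) (rstar wstar D : ℝ) (hD : D = (⌈wstar - rstar⌉ : ℝ))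
    (hs1 : ∀ h ∈ G1, (∑ j, (b j h : ℝ)) - (∑ j, (a2 j : ℝ)) = D)
    (hs2 : ∀ h ∈ G2, (∑ j, (b j h : ℝ)) - (∑ j, (a1 j : ℝ)) = D)
    (c1 c2 : J → ℝ)
    (hc1 : ∀ j, c1 j = (∑ h ∈ G1, (b j h : ℝ)) + a2 j - ∑ j, (a2 j : ℝ))
    (hc2 : ∀ j, c2 j = (∑ h ∈ G2, (b j h : ℝ)) + a1 j - ∑ j, (a1 j : ℝ))
    (y : J → M → ℝ) (x1 x2 : J → ℝ) (r : ℝ)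
    (hcol : ∀ h, ∑ j, y j h = r + D)
    (hA : ∀ j, ∑ h, y j h ≤ r + D)
    (hE : ∀ j, r + c1 j + c2 j ≤ ∑ h, y j h)
    (hC : ∀ j, r + c1 j ≤ ∑ h ∈ G1, y j h + x2 j)
    (hDd : ∀ j, r + c2 j ≤ ∑ h ∈ G2, y j h + x1 j)
    (hy0 : ∀ j h, 0 ≤ y j h) (hyb : ∀ j h, y j h ≤ b j h)
    (hx10 : ∀ j, 0 ≤ x1 j) (hx1a : ∀ j, x1 j ≤ a1 j)
    (hx20 : ∀ j, 0 ≤ x2 j) (hx2a : ∀ j, x2 j ≤ a2 j)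
    (hsx1 : ∑ j, x1 j ≤ r) (hsx2 : ∑ j, x2 j ≤ r)
    (hra1 : r ≤ ∑ j, (a1 j : ℝ)) (hra2 : r ≤ ∑ j, (a2 j : ℝ))
    (hfl : (⌊rstar⌋ : ℝ) ≤ r) :
    ∃ x1' x2' : J → ℝ, FeasibleLP G1 G2 b a1 a2 rstar wstar y x1' x2' r (r + D) := by
  have hr0 : 0 ≤ r := (Finset.sum_nonneg fun j _ => hx10 j).trans hsx1
  set lo1 : J → ℝ := fun j => max 0 (r + c2 j - ∑ h ∈ G2, y j h) with hlo1
  set lo2 : J → ℝ := fun j => max 0 (r + c1 j - ∑ h ∈ G1, y j h) with hlo2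
  have l1x : ∀ j, lo1 j ≤ x1 j := fun j => max_le (hx10 j) (by linarith [hDd j])
  have l2x : ∀ j, lo2 j ≤ x2 j := fun j => max_le (hx20 j) (by linarith [hC j])
  have l10 : ∀ j, 0 ≤ lo1 j := fun j => le_max_left _ _
  have l20 : ∀ j, 0 ≤ lo2 j := fun j => le_max_left _ _
  have sl1 : ∑ j, lo1 j ≤ r := (Finset.sum_le_sum fun j _ => l1x j).trans hsx1
  have sl2 : ∑ j, lo2 j ≤ r := (Finset.sum_le_sum fun j _ => l2x j).trans hsx2
  have l1r : ∀ j, lo1 j ≤ r := fun j =>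
    (Finset.single_le_sum (fun j _ => l10 j) (Finset.mem_univ j)).trans sl1
  have l2r : ∀ j, lo2 j ≤ r := fun j =>
    (Finset.single_le_sum (fun j _ => l20 j) (Finset.mem_univ j)).trans sl2
  have l12 : ∀ j, lo1 j + lo2 j ≤ r := by
    intro j
    have h1 := l1r j
    have h2 := l2r j
    have h3 := hE j
    rw [sum_cover hdisj hcover] at h3
    rcases max_choice 0 (r + c2 j - ∑ h ∈ G2, y j h) with h | h <;>
    rcases max_choice 0 (r + c1 j - ∑ h ∈ G1, y j h) with h' | h' <;>
    simp only [hlo1, hlo2, h, h'] at h1 h2 ⊢ <;> linarith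
  have yb1 : ∀ j, ∑ h ∈ G1, y j h ≤ ∑ h ∈ G1, (b j h : ℝ) := fun j =>
    Finset.sum_le_sum fun h _ => hyb j h
  have yb2 : ∀ j, ∑ h ∈ G2, y j h ≤ ∑ h ∈ G2, (b j h : ℝ) := fun j =>
    Finset.sum_le_sum fun h _ => hyb j h
  have m1 : ∀ j, r + c2 j - ∑ h ∈ G2, y j h ≤ lo1 j := fun j => le_max_right _ _
  have m2 : ∀ j, r + c1 j - ∑ h ∈ G1, y j h ≤ lo2 j := fun j => le_max_right _ _
  obtain ⟨z1, hz1l, hz1a, hz1q, hz1s⟩ := fill_aux lo1 lo2 (fun j => (a1 j : ℝ)) r l10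
    (fun j => (l1x j).trans (hx1a j)) l20 l12 sl1 sl2 hra1 (by
      intro t
      have := m1 t; have := yb2 t; have := hc2 t
      linarith)
  obtain ⟨z2, hz2l, hz2a, hz2q, hz2s⟩ := fill_aux lo2 z1 (fun j => (a2 j : ℝ)) r l20
    (fun j => (l2x j).trans (hx2a j)) (fun j => (l10 j).trans (hz1l j))
    (fun j => by linarith [hz1q j]) sl2 hz1s.le hra2 (by
      intro t
      have := m2 t; have := yb1 t; have := hc1 t
      linarith)
  refine ⟨z1, z2, ⟨?_, ?_, hA, fun j h => ⟨hy0 j h, hyb j h⟩, hz1s, hz2s,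
    fun j => by linarith [hz2q j], fun j => ⟨(l10 j).trans (hz1l j), hz1a j⟩,
    fun j => ⟨(l20 j).trans (hz2l j), hz2a j⟩, ?_, ?_⟩, by rw [← hD]; ring, hfl⟩
  · intro h hh
    have := hs1 h hh; have := hcol h
    constructor <;> linarith
  · intro h hh
    have := hs2 h hh; have := hcol h
    constructor <;> linarith
  · intro j
    rw [Finset.sum_sub_distrib]
    have := m2 j; have := hz2l j; have := hc1 j
    linarith
  · intro j
    rw [Finset.sum_sub_distrib]
    have := m1 j; have := hz1l j; have := hc2 j
    linarith

theorem ev_le {f g : ℝ} (hf : f ≤ 0) (hg : f = 0 → g ≤ 0) :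
    ∀ᶠ t in nhdsWithin (0 : ℝ) (Set.Ioi 0), f + t * g ≤ 0 := by
  rcases eq_or_lt_of_le hf with h | h
  · filter_upwards [self_mem_nhdsWithin] with t ht
    have := hg h
    have ht : 0 < t := ht
    nlinarith
  · have hc : Filter.Tendsto (fun t : ℝ => f + t * g) (nhdsWithin 0 (Set.Ioi 0)) (nhds (f + 0 * g)) := by
      refine Filter.Tendsto.mono_left ?_ nhdsWithin_le_nhds
      exact (Continuous.tendsto (by fun_prop) 0)
    rw [zero_mul, add_zero] at hc
    filter_upwards [hc.eventually (gt_mem_nhds h)] with t ht using ht.le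

theorem no_direction {J M : Type*} [Fintype J] [Fintype M] [DecidableEq J] [DecidableEq M]
    (G1 G2 : Finset M) (hdisj : Disjoint G1 G2) (hcover : G1 ∪ G2 = Finset.univ)
    (b : J → M → ℕ) (a1 a2 : J → ℕ) (rstar wstar D : ℝ) (hD : D = (⌈wstar - rstar⌉ : ℝ))
    (hs1 : ∀ h ∈ G1, (∑ j, (b j h : ℝ)) - (∑ j, (a2 j : ℝ)) = D)
    (hs2 : ∀ h ∈ G2, (∑ j, (b j h : ℝ)) - (∑ j, (a1 j : ℝ)) = D)
    (c1 c2 : J → ℝ)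
    (hc1 : ∀ j, c1 j = (∑ h ∈ G1, (b j h : ℝ)) + a2 j - ∑ j, (a2 j : ℝ))
    (hc2 : ∀ j, c2 j = (∑ h ∈ G2, (b j h : ℝ)) + a1 j - ∑ j, (a1 j : ℝ))
    (y : J → M → ℝ) (x1 x2 : J → ℝ) (r : ℝ)
    (hcol : ∀ h, ∑ j, y j h = r + D)
    (hA : ∀ j, ∑ h, y j h ≤ r + D)
    (hE : ∀ j, r + c1 j + c2 j ≤ ∑ h, y j h)
    (hC : ∀ j, r + c1 j ≤ ∑ h ∈ G1, y j h + x2 j)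
    (hDd : ∀ j, r + c2 j ≤ ∑ h ∈ G2, y j h + x1 j)
    (hy0 : ∀ j h, 0 ≤ y j h) (hyb : ∀ j h, y j h ≤ b j h)
    (hx10 : ∀ j, 0 ≤ x1 j) (hx1a : ∀ j, x1 j ≤ a1 j)
    (hx20 : ∀ j, 0 ≤ x2 j) (hx2a : ∀ j, x2 j ≤ a2 j)
    (hsx1 : ∑ j, x1 j = r) (hsx2 : ∑ j, x2 j = r)
    (hfl : (⌊rstar⌋ : ℝ) < r)
    (hopt : ∀ y' x1' x2' r' w',
      FeasibleLP G1 G2 b a1 a2 rstar wstar y' x1' x2' r' w' → r ≤ r')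
    (dy : J → M → ℝ) (d1 d2 : J → ℝ) (dr : ℝ)
    (kcol : ∀ h, ∑ j, dy j h = dr)
    (kA : ∀ j, ∑ h, y j h = r + D → ∑ h, dy j h ≤ dr)
    (kE : ∀ j, ∑ h, y j h = r + c1 j + c2 j → dr ≤ ∑ h, dy j h)
    (kC : ∀ j, ∑ h ∈ G1, y j h + x2 j = r + c1 j → dr ≤ ∑ h ∈ G1, dy j h + d2 j)
    (kDd : ∀ j, ∑ h ∈ G2, y j h + x1 j = r + c2 j → dr ≤ ∑ h ∈ G2, dy j h + d1 j)
    (ky0 : ∀ j h, y j h = 0 → 0 ≤ dy j h) (kyb : ∀ j h, y j h = b j h → dy j h ≤ 0)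
    (kx10 : ∀ j, x1 j = 0 → 0 ≤ d1 j) (kx1a : ∀ j, x1 j = a1 j → d1 j ≤ 0)
    (kx20 : ∀ j, x2 j = 0 → 0 ≤ d2 j) (kx2a : ∀ j, x2 j = a2 j → d2 j ≤ 0)
    (ks1 : ∑ j, d1 j ≤ dr) (ks2 : ∑ j, d2 j ≤ dr) : 0 ≤ dr := by
  by_contra hdr
  push Not at hdr
  have eA := Filter.eventually_all.mpr fun j =>
    ev_le (f := ∑ h, y j h - (r + D)) (g := ∑ h, dy j h - dr) (by linarith [hA j])
      (fun h => by linarith [kA j (by linarith)])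
  have eE := Filter.eventually_all.mpr fun j =>
    ev_le (f := r + c1 j + c2 j - ∑ h, y j h) (g := dr - ∑ h, dy j h) (by linarith [hE j])
      (fun h => by linarith [kE j (by linarith)])
  have eC := Filter.eventually_all.mpr fun j =>
    ev_le (f := r + c1 j - (∑ h ∈ G1, y j h + x2 j)) (g := dr - (∑ h ∈ G1, dy j h + d2 j))
      (by linarith [hC j]) (fun h => by linarith [kC j (by linarith)])
  have eD := Filter.eventually_all.mpr fun j =>
    ev_le (f := r + c2 j - (∑ h ∈ G2, y j h + x1 j)) (g := dr - (∑ h ∈ G2, dy j h + d1 j))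
      (by linarith [hDd j]) (fun h => by linarith [kDd j (by linarith)])
  have ey0 := Filter.eventually_all.mpr fun j => Filter.eventually_all.mpr fun h =>
    ev_le (f := - y j h) (g := - dy j h) (by linarith [hy0 j h])
      (fun h' => by linarith [ky0 j h (by linarith)])
  have eyb := Filter.eventually_all.mpr fun j => Filter.eventually_all.mpr fun h =>
    ev_le (f := y j h - b j h) (g := dy j h) (by linarith [hyb j h])
      (fun h' => by linarith [kyb j h (by linarith)])
  have e10 := Filter.eventually_all.mpr fun j =>
    ev_le (f := - x1 j) (g := - d1 j) (by linarith [hx10 j])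
      (fun h' => by linarith [kx10 j (by linarith)])
  have e1a := Filter.eventually_all.mpr fun j =>
    ev_le (f := x1 j - a1 j) (g := d1 j) (by linarith [hx1a j])
      (fun h' => by linarith [kx1a j (by linarith)])
  have e20 := Filter.eventually_all.mpr fun j =>
    ev_le (f := - x2 j) (g := - d2 j) (by linarith [hx20 j])
      (fun h' => by linarith [kx20 j (by linarith)])
  have e2a := Filter.eventually_all.mpr fun j =>
    ev_le (f := x2 j - a2 j) (g := d2 j) (by linarith [hx2a j])
      (fun h' => by linarith [kx2a j (by linarith)])
  have efl := ev_le (f := (⌊rstar⌋ : ℝ) - r) (g := - dr) (by linarith) (fun h => by linarith)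
  have hall := eA.and <| eE.and <| eC.and <| eD.and <| ey0.and <| eyb.and <| e10.and <| e1a.and <|
    e20.and <| e2a.and <| efl.and self_mem_nhdsWithin
  obtain ⟨t, tA, tE, tC, tD, ty0, tyb, t10, t1a, t20, t2a, tfl, ht⟩ := hall.exists
  have ht : 0 < t := ht
  have htdr : t * dr < 0 := mul_neg_of_pos_of_neg ht hdr
  have sy : ∀ (G : Finset M) j, ∑ h ∈ G, (y j h + t * dy j h)
      = ∑ h ∈ G, y j h + t * ∑ h ∈ G, dy j h := fun G j => by
    rw [Finset.sum_add_distrib, Finset.mul_sum]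
  have sx : ∀ (p q : J → ℝ), ∑ j, (p j + t * q j) = ∑ j, p j + t * ∑ j, q j := fun p q => by
    rw [Finset.sum_add_distrib, Finset.mul_sum]
  have hra1 : r ≤ ∑ j, (a1 j : ℝ) := hsx1 ▸ Finset.sum_le_sum fun j _ => hx1a j
  have hra2 : r ≤ ∑ j, (a2 j : ℝ) := hsx2 ▸ Finset.sum_le_sum fun j _ => hx2a j
  obtain ⟨z1, z2, hz⟩ := repair G1 G2 hdisj hcover b a1 a2 rstar wstar D hD hs1 hs2 c1 c2 hc1 hc2
    (fun j h => y j h + t * dy j h) (fun j => x1 j + t * d1 j) (fun j => x2 j + t * d2 j)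
    (r + t * dr)
    (fun h => by rw [sx (fun j => y j h) (fun j => dy j h), hcol, kcol]; ring)
    (fun j => by rw [sy]; linarith [tA j])
    (fun j => by rw [sy]; linarith [tE j])
    (fun j => by rw [sy]; linarith [tC j])
    (fun j => by rw [sy]; linarith [tD j])
    (fun j h => by linarith [ty0 j h]) (fun j h => by linarith [tyb j h])
    (fun j => by linarith [t10 j]) (fun j => by linarith [t1a j])
    (fun j => by linarith [t20 j]) (fun j => by linarith [t2a j])
    (by rw [sx, hsx1]; linarith [mul_le_mul_of_nonneg_left ks1 ht.le])
    (by rw [sx, hsx2]; linarith [mul_le_mul_of_nonneg_left ks2 ht.le])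
    (by linarith) (by linarith) (by linarith)
  have := hopt _ _ _ _ _ hz
  linarith

theorem farkas_active {V : Type*} [AddCommGroup V] [Module ℝ V] {ι : Type*} [Fintype ι]
    (act : ι → Prop) (l : ι → V →ₗ[ℝ] ℝ) (φ : V →ₗ[ℝ] ℝ)
    (H : ∀ v, (∀ i, act i → 0 ≤ l i v) → 0 ≤ φ v) :
    ∃ c : ι → ℝ, (∀ i, 0 ≤ c i) ∧ (∀ i, 0 < c i → act i) ∧ ∀ v, φ v = ∑ i, c i * l i v := by
  classical
  obtain ⟨c, hc0, hc⟩ := farkas_aux (Finset.univ.filter act) l φ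
    (fun v hv => H v fun i hi => hv i (by simpa using hi))
  refine ⟨fun i => if act i then c i else 0, fun i => ?_, fun i => ?_, fun v => ?_⟩
  · dsimp only; split_ifs
    · exact hc0 i
    · exact le_rfl
  · dsimp only; split_ifs with h
    · exact fun _ => h
    · exact fun h => absurd h (lt_irrefl _)
  · rw [hc v, Finset.sum_filter]
    refine Finset.sum_congr rfl fun i _ => ?_
    by_cases h : act i <;> simp [h]

theorem dual_exists {J M : Type*} [Fintype J] [Fintype M] [DecidableEq J] [DecidableEq M]
    (G1 G2 : Finset M) (hdisj : Disjoint G1 G2)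
    (pA pE pC pD : J → Prop) (p0 pb : J → M → Prop) (q10 q1a q20 q2a : J → Prop)
    (H : ∀ (dy : J → M → ℝ) (d1 d2 : J → ℝ) (dr : ℝ),
      (∀ h, ∑ j, dy j h = dr) →
      (∀ j, pA j → ∑ h, dy j h ≤ dr) →
      (∀ j, pE j → dr ≤ ∑ h, dy j h) →
      (∀ j, pC j → dr ≤ ∑ h ∈ G1, dy j h + d2 j) →
      (∀ j, pD j → dr ≤ ∑ h ∈ G2, dy j h + d1 j) →
      (∀ j h, p0 j h → 0 ≤ dy j h) → (∀ j h, pb j h → dy j h ≤ 0) →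
      (∀ j, q10 j → 0 ≤ d1 j) → (∀ j, q1a j → d1 j ≤ 0) →
      (∀ j, q20 j → 0 ≤ d2 j) → (∀ j, q2a j → d2 j ≤ 0) →
      (∑ j, d1 j ≤ dr) → (∑ j, d2 j ≤ dr) → 0 ≤ dr) :
    ∃ (A γ δ : J → ℝ) (lam : M → ℝ) (m1 m2 : ℝ),
      (∀ j, 0 ≤ γ j) ∧ (∀ j, 0 ≤ δ j) ∧ 0 ≤ m1 ∧ 0 ≤ m2 ∧
      (∀ j, 0 < A j → pA j) ∧ (∀ j, A j < 0 → pE j) ∧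
      (∀ j, 0 < γ j → pC j) ∧ (∀ j, 0 < δ j → pD j) ∧
      (∀ j, ∀ h ∈ G1, A j - γ j < lam h → pb j h) ∧
      (∀ j, ∀ h ∈ G1, lam h < A j - γ j → p0 j h) ∧
      (∀ j, ∀ h ∈ G2, A j - δ j < lam h → pb j h) ∧
      (∀ j, ∀ h ∈ G2, lam h < A j - δ j → p0 j h) ∧
      (∀ j, ¬ q10 j → ¬ q1a j → δ j = m1) ∧
      (∀ j, ¬ q20 j → ¬ q2a j → γ j = m2) ∧
      ∑ j, A j - ∑ j, γ j - ∑ j, δ j - ∑ h, lam h + m1 + m2 = 1 := by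
  let V := (J → M → ℝ) × (J → ℝ) × (J → ℝ) × ℝ
  let Y : J → M → V →ₗ[ℝ] ℝ := fun j h =>
    (LinearMap.proj h).comp ((LinearMap.proj j).comp (LinearMap.fst ℝ (J → M → ℝ) _))
  let X1 : J → V →ₗ[ℝ] ℝ := fun j =>
    (LinearMap.proj j).comp ((LinearMap.fst ℝ (J → ℝ) _).comp (LinearMap.snd ℝ (J → M → ℝ) _))
  let X2 : J → V →ₗ[ℝ] ℝ := fun j =>
    (LinearMap.proj j).comp ((LinearMap.fst ℝ (J → ℝ) ℝ).comp
      ((LinearMap.snd ℝ (J → ℝ) _).comp (LinearMap.snd ℝ (J → M → ℝ) _)))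
  let R : V →ₗ[ℝ] ℝ := (LinearMap.snd ℝ (J → ℝ) ℝ).comp
      ((LinearMap.snd ℝ (J → ℝ) _).comp (LinearMap.snd ℝ (J → M → ℝ) _))
  have hY : ∀ j h dy d1 d2 dr, Y j h (dy, d1, d2, dr) = dy j h := fun _ _ _ _ _ _ => rfl
  have hX1 : ∀ j dy d1 d2 dr, X1 j (dy, d1, d2, dr) = d1 j := fun _ _ _ _ _ => rfl
  have hX2 : ∀ j dy d1 d2 dr, X2 j (dy, d1, d2, dr) = d2 j := fun _ _ _ _ _ => rfl
  have hR : ∀ dy d1 d2 dr, R (dy, d1, d2, dr) = dr := fun _ _ _ _ => rfl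
  clear_value Y X1 X2 R
  let I := M ⊕ M ⊕ J ⊕ J ⊕ J ⊕ J ⊕ (J × M) ⊕ (J × M) ⊕ J ⊕ J ⊕ J ⊕ J ⊕ Unit ⊕ Unit
  let act : I → Prop := Sum.elim (fun _ => True) <| Sum.elim (fun _ => True) <|
    Sum.elim pA <| Sum.elim pE <| Sum.elim pC <| Sum.elim pD <|
    Sum.elim (fun p => p0 p.1 p.2) <| Sum.elim (fun p => pb p.1 p.2) <|
    Sum.elim q10 <| Sum.elim q1a <| Sum.elim q20 <| Sum.elim q2a <|
    Sum.elim (fun _ => True) (fun _ => True)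
  let l : I → V →ₗ[ℝ] ℝ := Sum.elim (fun h => ∑ j, Y j h - R) <|
    Sum.elim (fun h => R - ∑ j, Y j h) <|
    Sum.elim (fun j => R - ∑ h, Y j h) <| Sum.elim (fun j => ∑ h, Y j h - R) <|
    Sum.elim (fun j => ∑ h ∈ G1, Y j h + X2 j - R) <|
    Sum.elim (fun j => ∑ h ∈ G2, Y j h + X1 j - R) <|
    Sum.elim (fun p => Y p.1 p.2) <| Sum.elim (fun p => - Y p.1 p.2) <|
    Sum.elim X1 <| Sum.elim (fun j => - X1 j) <| Sum.elim X2 <| Sum.elim (fun j => - X2 j) <|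
    Sum.elim (fun _ => R - ∑ j, X1 j) (fun _ => R - ∑ j, X2 j)
  obtain ⟨c, hc0, hca, hc⟩ := farkas_active act l R (by
    rintro ⟨dy, d1, d2, dr⟩ hv
    rw [hR]
    simp only [I, Sum.forall, act, l, Sum.elim_inl, Sum.elim_inr, Prod.forall, LinearMap.sub_apply,
      LinearMap.add_apply, LinearMap.neg_apply, LinearMap.sum_apply, hY, hX1, hX2, hR,
      forall_true_left] at hv
    obtain ⟨v1, v2, v3, v4, v5, v6, v7, v8, v9, v10, v11, v12, v13, v14⟩ := hv
    exact H dy d1 d2 dr (fun h => by linarith [v1 h, v2 h])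
      (fun j hj => by linarith [v3 j hj]) (fun j hj => by linarith [v4 j hj])
      (fun j hj => by linarith [v5 j hj]) (fun j hj => by linarith [v6 j hj])
      (fun j h hj => by linarith [v7 j h hj]) (fun j h hj => by linarith [v8 j h hj])
      (fun j hj => by linarith [v9 j hj]) (fun j hj => by linarith [v10 j hj])
      (fun j hj => by linarith [v11 j hj]) (fun j hj => by linarith [v12 j hj])
      (by linarith [v13 ()]) (by linarith [v14 ()]))
  simp only [I, Sum.forall, act, Sum.elim_inl, Sum.elim_inr, Prod.forall] at hc0 hca
  obtain ⟨n1, n2, n3, n4, n5, n6, n7, n8, n9, n10, n11, n12, n13, n14⟩ := hc0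
  obtain ⟨-, -, s3, s4, s5, s6, s7, s8, s9, s10, s11, s12, -, -⟩ := hca
  have hc' : ∀ dy d1 d2 dr, _ := fun dy d1 d2 dr => hc (dy, d1, d2, dr)
  simp only [I, Fintype.sum_sum_type, l, Sum.elim_inl, Sum.elim_inr, LinearMap.sub_apply,
      LinearMap.add_apply, LinearMap.neg_apply, LinearMap.sum_apply, hY, hX1, hX2, hR,
      Fintype.sum_prod_type, Finset.univ_unique, Finset.sum_singleton] at hc'
  obtain ⟨k1, hk1⟩ : ∃ k : M → ℝ, ∀ i, c (Sum.inl i) = k i := ⟨fun _ => _, fun _ => rfl⟩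
  obtain ⟨k2, hk2⟩ : ∃ k : M → ℝ, ∀ i, c (Sum.inr (Sum.inl i)) = k i := ⟨fun _ => _, fun _ => rfl⟩
  obtain ⟨k3, hk3⟩ : ∃ k : J → ℝ, ∀ i, c (Sum.inr (Sum.inr (Sum.inl i))) = k i := ⟨fun _ => _, fun _ => rfl⟩
  obtain ⟨k4, hk4⟩ : ∃ k : J → ℝ, ∀ i, c (Sum.inr (Sum.inr (Sum.inr (Sum.inl i)))) = k i := ⟨fun _ => _, fun _ => rfl⟩
  obtain ⟨k5, hk5⟩ : ∃ k : J → ℝ, ∀ i, c (Sum.inr (Sum.inr (Sum.inr (Sum.inr (Sum.inl i))))) = k i := ⟨fun _ => _, fun _ => rfl⟩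
  obtain ⟨k6, hk6⟩ : ∃ k : J → ℝ, ∀ i, c (Sum.inr (Sum.inr (Sum.inr (Sum.inr (Sum.inr (Sum.inl i)))))) = k i := ⟨fun _ => _, fun _ => rfl⟩
  obtain ⟨k7, hk7⟩ : ∃ k : J → M → ℝ, ∀ j h, c (Sum.inr (Sum.inr (Sum.inr (Sum.inr (Sum.inr (Sum.inr (Sum.inl (j, h)))))))) = k j h :=
    ⟨fun _ _ => _, fun _ _ => rfl⟩
  obtain ⟨k8, hk8⟩ : ∃ k : J → M → ℝ, ∀ j h, c (Sum.inr (Sum.inr (Sum.inr (Sum.inr (Sum.inr (Sum.inr (Sum.inr (Sum.inl (j, h))))))))) = k j h :=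
    ⟨fun _ _ => _, fun _ _ => rfl⟩
  obtain ⟨k9, hk9⟩ : ∃ k : J → ℝ, ∀ i, c (Sum.inr (Sum.inr (Sum.inr (Sum.inr (Sum.inr (Sum.inr (Sum.inr (Sum.inr (Sum.inl i))))))))) = k i := ⟨fun _ => _, fun _ => rfl⟩
  obtain ⟨k10, hk10⟩ : ∃ k : J → ℝ, ∀ i, c (Sum.inr (Sum.inr (Sum.inr (Sum.inr (Sum.inr (Sum.inr (Sum.inr (Sum.inr (Sum.inr (Sum.inl i)))))))))) = k i := ⟨fun _ => _, fun _ => rfl⟩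
  obtain ⟨k11, hk11⟩ : ∃ k : J → ℝ, ∀ i, c (Sum.inr (Sum.inr (Sum.inr (Sum.inr (Sum.inr (Sum.inr (Sum.inr (Sum.inr (Sum.inr (Sum.inr (Sum.inl i))))))))))) = k i := ⟨fun _ => _, fun _ => rfl⟩
  obtain ⟨k12, hk12⟩ : ∃ k : J → ℝ, ∀ i, c (Sum.inr (Sum.inr (Sum.inr (Sum.inr (Sum.inr (Sum.inr (Sum.inr (Sum.inr (Sum.inr (Sum.inr (Sum.inr (Sum.inl i)))))))))))) = k i := ⟨fun _ => _, fun _ => rfl⟩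
  obtain ⟨k13, hk13⟩ : ∃ k : ℝ, c (Sum.inr (Sum.inr (Sum.inr (Sum.inr (Sum.inr (Sum.inr (Sum.inr (Sum.inr (Sum.inr (Sum.inr (Sum.inr (Sum.inr (Sum.inl ()))))))))))))) = k := ⟨_, rfl⟩
  obtain ⟨k14, hk14⟩ : ∃ k : ℝ, c (Sum.inr (Sum.inr (Sum.inr (Sum.inr (Sum.inr (Sum.inr (Sum.inr (Sum.inr (Sum.inr (Sum.inr (Sum.inr (Sum.inr (Sum.inr ()))))))))))))) = k := ⟨_, rfl⟩
  have hu : (default : Unit) = () := rfl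
  simp only [hu, hk1, hk2, hk3, hk4, hk5, hk6, hk7, hk8, hk9, hk10, hk11, hk12, hk13, hk14] at n1 n2 n3 n4 n5 n6 n7 n8 n9 n10 n11 n12 n13 n14 s3 s4 s5 s6 s7 s8 s9 s10 s11 s12 hc'
  clear hk1 hk2 hk3 hk4 hk5 hk6 hk7 hk8 hk9 hk10 hk11 hk12 hk13 hk14
  have hr := hc' 0 0 0 1
  have hx1 := fun j => hc' 0 (Pi.single j 1) 0 0
  have hx2 := fun j => hc' 0 0 (Pi.single j 1) 0
  have hy := fun j h => hc' (fun j' h' => if j' = j then (if h' = h then 1 else 0) else 0) 0 0 0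
  clear hc' hc
  simp [Finset.sum_neg_distrib] at hr
  simp [Pi.single_apply] at hx1
  simp [Pi.single_apply] at hx2
  simp at hy
  have g12 : ∀ h ∈ G1, h ∉ G2 := fun h h1 h2 => Finset.disjoint_left.mp hdisj h1 h2
  have hy1 : ∀ j, ∀ h ∈ G1, k3 j - k4 j - k5 j - (k1 h - k2 h) = k7 j h - k8 j h := by
    intro j h hh
    have := hy j h
    rw [if_pos hh, if_neg (g12 h hh)] at this
    linarith
  have hy2 : ∀ j, ∀ h ∈ G2, k3 j - k4 j - k6 j - (k1 h - k2 h) = k7 j h - k8 j h := by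
    intro j h hh
    have := hy j h
    rw [if_pos hh, if_neg (fun h1 => g12 h h1 hh)] at this
    linarith
  refine ⟨fun j => k3 j - k4 j, k5, k6, fun h => k1 h - k2 h, k13, k14, n5, n6, n13 (), n14 (),
    fun j hj => s3 j (by linarith [n4 j]), fun j hj => s4 j (by linarith [n3 j]), s5, s6,
    fun j h hh hl => s8 j h (by linarith [hy1 j h hh, n7 j h]),
    fun j h hh hl => s7 j h (by linarith [hy1 j h hh, n8 j h]),
    fun j h hh hl => s8 j h (by linarith [hy2 j h hh, n7 j h]),
    fun j h hh hl => s7 j h (by linarith [hy2 j h hh, n8 j h]), ?_, ?_, ?_⟩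
  · intro j h0 ha
    have z1 : k9 j ≤ 0 := not_lt.mp fun h => h0 (s9 j h)
    have z2 : k10 j ≤ 0 := not_lt.mp fun h => ha (s10 j h)
    linarith [hx1 j, n9 j, n10 j]
  · intro j h0 ha
    have z1 : k11 j ≤ 0 := not_lt.mp fun h => h0 (s11 j h)
    have z2 : k12 j ≤ 0 := not_lt.mp fun h => ha (s12 j h)
    linarith [hx2 j, n11 j, n12 j]
  · simp only [Finset.sum_sub_distrib]
    linarith

/-- Indicator of `τ ≤ π`. -/
def lbit (τ π : ℝ) : ℤ := if τ ≤ π then 1 else 0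

/-- The level function. -/
def lev {J M : Type*} [Fintype J] [Fintype M] (A γ δ : J → ℝ) (lam : M → ℝ) (τ : ℝ) : ℤ :=
  (∑ h, (lbit τ (lam h) - lbit τ 0)) -
    ∑ j, (lbit τ (A j - γ j) + lbit τ (A j - δ j) - lbit τ (A j) - lbit τ 0)

theorem lbit_cases (τ π : ℝ) : (τ ≤ π ∧ lbit τ π = 1) ∨ (π < τ ∧ lbit τ π = 0) := by
  unfold lbit
  by_cases h : τ ≤ π
  · exact Or.inl ⟨h, if_pos h⟩
  · exact Or.inr ⟨not_le.mp h, if_neg h⟩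

theorem diff_cases (τ A γ : ℝ) (hγ : 0 ≤ γ) :
    lbit τ A - lbit τ (A - γ) = 0 ∨ (lbit τ A - lbit τ (A - γ) = 1 ∧ 0 < γ) := by
  rcases lbit_cases τ A with ⟨h, e⟩ | ⟨h, e⟩ <;>
  rcases lbit_cases τ (A - γ) with ⟨h', e'⟩ | ⟨h', e'⟩ <;> rw [e, e']
  · left; rfl
  · right; exact ⟨rfl, by linarith⟩
  · linarith
  · left; rfl

theorem level_dichotomy {J M : Type*} [Fintype J] [Fintype M] [DecidableEq J] [DecidableEq M]
    (G1 G2 : Finset M) (hdisj : Disjoint G1 G2) (hcover : G1 ∪ G2 = Finset.univ)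
    (b : J → M → ℕ) (D F : ℤ) (c1 c2 : J → ℤ)
    (y : J → M → ℝ) (x1 x2 : J → ℝ) (r ε : ℝ) (hr : r = F + ε)
    (hw : 0 < r + D)
    (hcol : ∀ h, ∑ j, y j h = r + D)
    (hA : ∀ j, ∑ h, y j h ≤ r + D)
    (hE : ∀ j, r + c1 j + c2 j ≤ ∑ h, y j h)
    (hy0 : ∀ j h, 0 ≤ y j h)
    (A γ δ : J → ℝ) (lam : M → ℝ)
    (hγ : ∀ j, 0 ≤ γ j) (hδ : ∀ j, 0 ≤ δ j)
    (tA : ∀ j, 0 < A j → ∑ h, y j h = r + D)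
    (tE : ∀ j, A j < 0 → ∑ h, y j h = r + c1 j + c2 j)
    (tC : ∀ j, 0 < γ j → ∑ h ∈ G1, y j h + x2 j = r + c1 j)
    (tD : ∀ j, 0 < δ j → ∑ h ∈ G2, y j h + x1 j = r + c2 j)
    (ub1 : ∀ j, ∀ h ∈ G1, A j - γ j < lam h → y j h = b j h)
    (u01 : ∀ j, ∀ h ∈ G1, lam h < A j - γ j → y j h = 0)
    (ub2 : ∀ j, ∀ h ∈ G2, A j - δ j < lam h → y j h = b j h)
    (u02 : ∀ j, ∀ h ∈ G2, lam h < A j - δ j → y j h = 0) (τ : ℝ) :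
    (lev A γ δ lam τ = 0 ∧
      (∀ j, (¬ ∃ z : ℤ, x2 j = z) → lbit τ (A j) - lbit τ (A j - γ j) = 0) ∧
      (∀ j, (¬ ∃ z : ℤ, x1 j = z) → lbit τ (A j) - lbit τ (A j - δ j) = 0)) ∨
    (1 ≤ lev A γ δ lam τ ∧ ∃ k : ℤ,
      ∑ j, ((lbit τ (A j) - lbit τ (A j - γ j) : ℤ) : ℝ) * x2 j +
      ∑ j, ((lbit τ (A j) - lbit τ (A j - δ j) : ℤ) : ℝ) * x1 j
        = (lev A γ δ lam τ : ℝ) * ε + k) := by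
  set g := lev A γ δ lam τ with hg
  set γ' : J → ℤ := fun j => lbit τ (A j) - lbit τ (A j - γ j) with hγ'
  set δ' : J → ℤ := fun j => lbit τ (A j) - lbit τ (A j - δ j) with hδ'
  have split : ∀ j, ∑ h, y j h = ∑ h ∈ G1, y j h + ∑ h ∈ G2, y j h := fun j =>
    sum_cover hdisj hcover (fun h => y j h)
  have y1n : ∀ j, 0 ≤ ∑ h ∈ G1, y j h := fun j => Finset.sum_nonneg fun h _ => hy0 j h
  have y2n : ∀ j, 0 ≤ ∑ h ∈ G2, y j h := fun j => Finset.sum_nonneg fun h _ => hy0 j h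
  -- the pair terms
  set I1 : J → M → ℤ := fun j h =>
    if lbit τ (A j - γ j) = 0 ∧ lbit τ (lam h) = 1 then (b j h : ℤ) else 0 with hI1
  set I2 : J → M → ℤ := fun j h =>
    if lbit τ (A j - δ j) = 0 ∧ lbit τ (lam h) = 1 then (b j h : ℤ) else 0 with hI2
  have p1 : ∀ j, ∀ h ∈ G1, ((lbit τ (A j - γ j) : ℝ) - (lbit τ (lam h) : ℝ)) * y j h
      = - (I1 j h : ℝ) := by
    intro j h hh
    simp only [hI1]
    rcases lbit_cases τ (A j - γ j) with ⟨h1, e1⟩ | ⟨h1, e1⟩ <;>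
    rcases lbit_cases τ (lam h) with ⟨h2, e2⟩ | ⟨h2, e2⟩ <;> rw [e1, e2]
    · simp
    · rw [u01 j h hh (by linarith)]; simp
    · rw [ub1 j h hh (by linarith)]; simp
    · simp
  have p2 : ∀ j, ∀ h ∈ G2, ((lbit τ (A j - δ j) : ℝ) - (lbit τ (lam h) : ℝ)) * y j h
      = - (I2 j h : ℝ) := by
    intro j h hh
    simp only [hI2]
    rcases lbit_cases τ (A j - δ j) with ⟨h1, e1⟩ | ⟨h1, e1⟩ <;>
    rcases lbit_cases τ (lam h) with ⟨h2, e2⟩ | ⟨h2, e2⟩ <;> rw [e1, e2]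
    · simp
    · rw [u02 j h hh (by linarith)]; simp
    · rw [ub2 j h hh (by linarith)]; simp
    · simp
  set I : ℤ := ∑ j, (∑ h ∈ G1, I1 j h + ∑ h ∈ G2, I2 j h) with hI
  have hI0 : 0 ≤ I := by
    refine Finset.sum_nonneg fun j _ => add_nonneg (Finset.sum_nonneg fun h _ => ?_)
      (Finset.sum_nonneg fun h _ => ?_)
    · simp only [hI1]; split_ifs <;> simp
    · simp only [hI2]; split_ifs <;> simp
  set K : J → ℤ := fun j => if lbit τ (A j) - lbit τ 0 = -1 then D - c1 j - c2 j else 0 with hK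
  have hK0 : ∀ j, 0 ≤ K j := by
    intro j
    simp only [hK]
    split_ifs
    · have h1 := hA j
      have h2 := hE j
      have : ((c1 j + c2 j : ℤ) : ℝ) ≤ D := by push_cast; linarith
      have : c1 j + c2 j ≤ D := by exact_mod_cast this
      linarith
    · exact le_rfl
  have hKj : ∀ j, ((lbit τ (A j) : ℝ) - (lbit τ 0 : ℝ)) * ∑ h, y j h
      = ((lbit τ (A j) : ℝ) - (lbit τ 0 : ℝ)) * (r + D) + K j := by
    intro j
    simp only [hK]
    rcases lbit_cases τ (A j) with ⟨h1, e1⟩ | ⟨h1, e1⟩ <;>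
    rcases lbit_cases τ 0 with ⟨h2, e2⟩ | ⟨h2, e2⟩ <;> rw [e1, e2]
    · simp
    · rw [tA j (by linarith)]; simp
    · rw [tE j (by linarith)]; simp; ring
    · simp
  -- main identity
  have hmain : (g : ℝ) * (r + D) = I + ∑ j, (K j : ℝ)
      + ∑ j, (γ' j : ℝ) * (r + D - ∑ h ∈ G1, y j h)
      + ∑ j, (δ' j : ℝ) * (r + D - ∑ h ∈ G2, y j h) := by
    have hL : ∑ j, ∑ h, ((lbit τ (lam h) : ℝ) - (lbit τ 0 : ℝ)) * y j h
        = ∑ h, ((lbit τ (lam h) : ℝ) - (lbit τ 0 : ℝ)) * (r + D) := by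
      rw [Finset.sum_comm]
      refine Finset.sum_congr rfl fun h _ => ?_
      rw [← Finset.mul_sum, hcol]
    have hj : ∀ j, ∑ h, ((lbit τ (lam h) : ℝ) - (lbit τ 0 : ℝ)) * y j h
        = (((∑ h ∈ G1, I1 j h + ∑ h ∈ G2, I2 j h : ℤ)) : ℝ)
          + (lbit τ (A j - γ j) : ℝ) * ∑ h ∈ G1, y j h
          + (lbit τ (A j - δ j) : ℝ) * ∑ h ∈ G2, y j h - (lbit τ 0 : ℝ) * ∑ h, y j h := by
      intro j
      have e1 : ∑ h ∈ G1, (lbit τ (lam h) : ℝ) * y j h = ∑ h ∈ G1, (I1 j h : ℝ)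
          + (lbit τ (A j - γ j) : ℝ) * ∑ h ∈ G1, y j h := by
        rw [Finset.mul_sum, ← Finset.sum_add_distrib]
        exact Finset.sum_congr rfl fun h hh => by linarith [p1 j h hh]
      have e2 : ∑ h ∈ G2, (lbit τ (lam h) : ℝ) * y j h = ∑ h ∈ G2, (I2 j h : ℝ)
          + (lbit τ (A j - δ j) : ℝ) * ∑ h ∈ G2, y j h := by
        rw [Finset.mul_sum, ← Finset.sum_add_distrib]
        exact Finset.sum_congr rfl fun h hh => by linarith [p2 j h hh]
      simp only [sub_mul, Finset.sum_sub_distrib]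
      rw [sum_cover hdisj hcover (fun h => (lbit τ (lam h) : ℝ) * y j h), e1, e2,
        ← Finset.mul_sum]
      push_cast
      ring
    have e3 : (g : ℝ) * (r + D) = ∑ h, ((lbit τ (lam h) : ℝ) - (lbit τ 0 : ℝ)) * (r + D)
        - ∑ j, ((lbit τ (A j - γ j) : ℝ) + lbit τ (A j - δ j) - lbit τ (A j) - lbit τ 0)
          * (r + D) := by
      rw [hg, lev]; push_cast
      rw [sub_mul, Finset.sum_mul, Finset.sum_mul]
    rw [e3, ← hL, Finset.sum_congr rfl fun j _ => hj j, hI]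
    push_cast
    rw [← Finset.sum_sub_distrib, ← Finset.sum_add_distrib, ← Finset.sum_add_distrib,
      ← Finset.sum_add_distrib]
    refine Finset.sum_congr rfl fun j _ => ?_
    have h1 := hKj j
    rw [split j] at h1 ⊢
    simp only [hγ', hδ']
    push_cast
    linarith
  have hγn : ∀ j, 0 ≤ (γ' j : ℝ) * (r + D - ∑ h ∈ G1, y j h) := by
    intro j
    have h1 := hA j
    rw [split j] at h1
    rcases diff_cases τ (A j) (γ j) (hγ j) with h | ⟨h, -⟩
    · simp only [hγ', h]; simp
    · simp only [hγ', h]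
      have := y2n j
      push_cast; linarith
  have hδn : ∀ j, 0 ≤ (δ' j : ℝ) * (r + D - ∑ h ∈ G2, y j h) := by
    intro j
    have h1 := hA j
    rw [split j] at h1
    rcases diff_cases τ (A j) (δ j) (hδ j) with h | ⟨h, -⟩
    · simp only [hδ', h]; simp
    · simp only [hδ', h]
      have := y1n j
      push_cast; linarith
  have sγ := Finset.sum_nonneg fun j (_ : j ∈ Finset.univ) => hγn j
  have sδ := Finset.sum_nonneg fun j (_ : j ∈ Finset.univ) => hδn j
  have sK : 0 ≤ ∑ j, (K j : ℝ) := Finset.sum_nonneg fun j _ => by exact_mod_cast hK0 j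
  have sI : (0 : ℝ) ≤ I := by exact_mod_cast hI0
  have hg0 : 0 ≤ g := by
    by_contra hneg
    push Not at hneg
    have h1 : (g : ℝ) < 0 := by exact_mod_cast hneg
    have := mul_neg_of_neg_of_pos h1 hw
    linarith
  have tγ : ∀ j, (γ' j : ℝ) * (r + D - ∑ h ∈ G1, y j h)
      = ((γ' j * (D - c1 j) : ℤ) : ℝ) + γ' j * x2 j := by
    intro j
    rcases diff_cases τ (A j) (γ j) (hγ j) with h | ⟨h, hp⟩
    · simp only [hγ', h]; simp
    · simp only [hγ', h]
      have := tC j hp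
      push_cast; linarith
  have tδ : ∀ j, (δ' j : ℝ) * (r + D - ∑ h ∈ G2, y j h)
      = ((δ' j * (D - c2 j) : ℤ) : ℝ) + δ' j * x1 j := by
    intro j
    rcases diff_cases τ (A j) (δ j) (hδ j) with h | ⟨h, hp⟩
    · simp only [hδ', h]; simp
    · simp only [hδ', h]
      have := tD j hp
      push_cast; linarith
  rcases eq_or_lt_of_le hg0 with h | h
  · left
    rw [← h] at hmain
    simp only [Int.cast_zero, zero_mul] at hmain
    have zγ := (Finset.sum_eq_zero_iff_of_nonneg fun j (_ : j ∈ Finset.univ) => hγn j).mp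
      (by linarith)
    have zδ := (Finset.sum_eq_zero_iff_of_nonneg fun j (_ : j ∈ Finset.univ) => hδn j).mp
      (by linarith)
    refine ⟨h.symm, fun j hj => ?_, fun j hj => ?_⟩
    · rcases diff_cases τ (A j) (γ j) (hγ j) with h | ⟨h, hp⟩
      · exact h
      · exfalso
        have h1 := zγ j (Finset.mem_univ j)
        rw [tγ j] at h1
        simp only [hγ', h] at h1
        exact hj ⟨c1 j - D, by push_cast at h1 ⊢; linarith⟩
    · rcases diff_cases τ (A j) (δ j) (hδ j) with h | ⟨h, hp⟩
      · exact h
      · exfalso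
        have h1 := zδ j (Finset.mem_univ j)
        rw [tδ j] at h1
        simp only [hδ', h] at h1
        exact hj ⟨c2 j - D, by push_cast at h1 ⊢; linarith⟩
  · right
    refine ⟨h, g * (F + D) - I - ∑ j, K j - ∑ j, γ' j * (D - c1 j) - ∑ j, δ' j * (D - c2 j), ?_⟩
    rw [Finset.sum_congr rfl fun j _ => tγ j, Finset.sum_congr rfl fun j _ => tδ j,
      Finset.sum_add_distrib, Finset.sum_add_distrib, hr] at hmain
    push_cast at hmain ⊢
    simp only [hγ', hδ'] at hmain ⊢
    push_cast at hmain ⊢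
    linarith

theorem split_int {J : Type*} [Fintype J] [DecidableEq J] (B : Finset J) (x : J → ℝ)
    (hB : ∀ j, j ∈ B ↔ ¬∃ z : ℤ, x j = (z : ℝ)) (n : J → ℤ) :
    ∃ k : ℤ, ∑ j, (n j : ℝ) * x j = ∑ j ∈ B, (n j : ℝ) * x j + k := by
  have h : ∀ j, ∃ z : ℤ, j ∉ B → x j = z := by
    intro j
    by_cases hj : j ∈ B
    · exact ⟨0, fun h => absurd hj h⟩
    · have := (not_congr (hB j)).mp hj
      push Not at this
      obtain ⟨z, hz⟩ := this
      exact ⟨z, fun _ => hz⟩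
  choose z hz using h
  refine ⟨∑ j ∈ Bᶜ, n j * z j, ?_⟩
  rw [← Finset.sum_add_sum_compl B]
  congr 1
  push_cast
  exact Finset.sum_congr rfl fun j hj => by rw [hz j (Finset.mem_compl.mp hj)]

/-- Cumulative sums of the fractional variables. -/
def cum {J : Type*} (B : Finset J) (x A : J → ℝ) (σ : ℝ) : ℝ :=
  ∑ j ∈ B, x j * (if A j < σ then 1 else 0)

theorem cum_shift {J : Type*} (B : Finset J) (x A γ : J → ℝ) (m τ : ℝ)
    (h : ∀ j ∈ B, γ j = m) :
    cum B x A (τ + m) - cum B x A τ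
      = ∑ j ∈ B, ((lbit τ (A j) - lbit τ (A j - γ j) : ℤ) : ℝ) * x j := by
  unfold cum
  rw [← Finset.sum_sub_distrib]
  refine Finset.sum_congr rfl fun j hj => ?_
  rw [h j hj]
  have e1 : A j < τ + m ↔ ¬ (τ ≤ A j - m) := by
    rw [not_le]; constructor <;> intro h <;> linarith
  have e2 : A j < τ ↔ ¬ (τ ≤ A j) := not_le.symm
  unfold lbit
  by_cases h1 : τ ≤ A j - m <;> by_cases h2 : τ ≤ A j <;> simp only [e1, e2, h1, h2] <;> simp

theorem cum_measurable {J : Type*} (B : Finset J) (x A : J → ℝ) : Measurable (cum B x A) := by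
  unfold cum
  refine Finset.measurable_sum _ fun j _ => Measurable.const_mul ?_ _
  exact Measurable.ite measurableSet_Ioi measurable_const measurable_const

theorem saw_measurable (ε : ℝ) : Measurable (saw ε) := by
  unfold saw
  exact (measurable_fract.div_const _).min ((measurable_const.sub measurable_fract).div_const _)

theorem bdd_integrable (f : ℝ → ℝ) (hm : Measurable f) (h0 : ∀ t, 0 ≤ f t) (h1 : ∀ t, f t ≤ 1)
    (a c : ℝ) : IntervalIntegrable f MeasureTheory.volume a c := by
  refine (intervalIntegrable_const (c := (1 : ℝ))).mono_fun hm.aestronglyMeasurable ?_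
  refine Filter.Eventually.of_forall fun t => ?_
  dsimp only
  rw [Real.norm_of_nonneg (h0 t), norm_one]
  exact h1 t

theorem shift_integral (f : ℝ → ℝ) (hm : Measurable f) (h0 : ∀ t, 0 ≤ f t) (h1 : ∀ t, f t ≤ 1)
    (R0 R m : ℝ) (hm0 : 0 ≤ m) (hR : R0 + m ≤ R) (hlow : ∀ t, t ≤ -R0 → f t = 0)
    (hhigh : ∀ t, R0 ≤ t → f t = 1) :
    ∫ t in (-R)..R, (f (t + m) - f t) = m := by
  have hi := bdd_integrable f hm h0 h1
  have hi' := bdd_integrable (fun t => f (t + m)) (hm.comp (measurable_id.add_const m))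
    (fun t => h0 _) (fun t => h1 _)
  rw [intervalIntegral.integral_sub (hi' _ _) (hi _ _), intervalIntegral.integral_comp_add_right]
  have e1 := intervalIntegral.integral_add_adjacent_intervals (hi (-R) (-R + m)) (hi (-R + m) (R + m))
  have e2 := intervalIntegral.integral_add_adjacent_intervals (hi (-R) R) (hi R (R + m))
  have e3 : ∫ t in (-R)..(-R + m), f t = 0 := by
    rw [intervalIntegral.integral_congr (g := fun _ => (0 : ℝ))]
    · simp
    · intro t ht
      rw [Set.uIcc_of_le (by linarith)] at ht
      exact hlow t (by linarith [ht.2])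
  have e4 : ∫ t in R..(R + m), f t = m := by
    rw [intervalIntegral.integral_congr (g := fun _ => (1 : ℝ))]
    · simp
    · intro t ht
      rw [Set.uIcc_of_le (by linarith)] at ht
      exact hhigh t (by linarith [ht.1])
  linarith

theorem lbit_measurable (π : ℝ) : Measurable fun τ => (lbit τ π : ℝ) := by
  unfold lbit
  have : (fun τ : ℝ => (((if τ ≤ π then 1 else 0 : ℤ)) : ℝ)) = fun τ => if τ ≤ π then 1 else 0 := by
    funext τ; split_ifs <;> simp
  rw [this]
  exact Measurable.ite measurableSet_Iic measurable_const measurable_const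

theorem lbit_integrable (π a c : ℝ) :
    IntervalIntegrable (fun τ => (lbit τ π : ℝ)) MeasureTheory.volume a c := by
  refine bdd_integrable _ (lbit_measurable π) (fun t => ?_) (fun t => ?_) a c <;>
  rcases lbit_cases t π with ⟨-, h⟩ | ⟨-, h⟩ <;> simp [h]

theorem lbit_integral (π R : ℝ) (h1 : -R ≤ π) (h2 : π ≤ R) :
    ∫ τ in (-R)..R, (lbit τ π : ℝ) = π + R := by
  rw [← intervalIntegral.integral_add_adjacent_intervals (lbit_integrable π (-R) π)
    (lbit_integrable π π R)]
  have e3 : ∫ t in (-R)..π, (lbit t π : ℝ) = π + R := by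
    rw [intervalIntegral.integral_congr (g := fun _ => (1 : ℝ))]
    · simp
    · intro t ht
      rw [Set.uIcc_of_le h1] at ht
      simp [lbit, ht.2]
  have e4 : ∫ t in π..R, (lbit t π : ℝ) = 0 := by
    rw [intervalIntegral.integral_congr_ae (g := fun _ => (0 : ℝ))]
    · simp
    · refine Filter.Eventually.of_forall fun t ht => ?_
      rw [Set.uIoc_of_le h2] at ht
      simp [lbit, not_le.mpr ht.1]
  rw [e3, e4, add_zero]

theorem lev_integral {J M : Type*} [Fintype J] [Fintype M] (A γ δ : J → ℝ) (lam : M → ℝ) (R : ℝ)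
    (hR : 0 ≤ R) (hA : ∀ j, |A j| ≤ R) (hu : ∀ j, |A j - γ j| ≤ R) (hv : ∀ j, |A j - δ j| ≤ R)
    (hl : ∀ h, |lam h| ≤ R) :
    IntervalIntegrable (fun τ => (lev A γ δ lam τ : ℝ)) MeasureTheory.volume (-R) R ∧
    ∫ τ in (-R)..R, (lev A γ δ lam τ : ℝ) = ∑ h, lam h - ∑ j, (A j - γ j - δ j) := by
  unfold lev
  push_cast
  have i1 : ∀ h, IntervalIntegrable (fun τ => (lbit τ (lam h) : ℝ) - lbit τ 0)
      MeasureTheory.volume (-R) R := fun h => (lbit_integrable _ _ _).sub (lbit_integrable _ _ _)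
  have i2 : ∀ j, IntervalIntegrable (fun τ => (lbit τ (A j - γ j) : ℝ) + lbit τ (A j - δ j)
      - lbit τ (A j) - lbit τ 0) MeasureTheory.volume (-R) R := fun h =>
    ((((lbit_integrable _ _ _).add (lbit_integrable _ _ _)).sub (lbit_integrable _ _ _))).sub
      (lbit_integrable _ _ _)
  have z := lbit_integral 0 R (by linarith) hR
  have s1 : IntervalIntegrable (fun τ => ∑ h, ((lbit τ (lam h) : ℝ) - lbit τ 0))
      MeasureTheory.volume (-R) R := by
    have := IntervalIntegrable.sum Finset.univ (fun h _ => i1 h)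
    rw [Finset.sum_fn] at this
    exact this
  have s2 : IntervalIntegrable (fun τ => ∑ j, ((lbit τ (A j - γ j) : ℝ) + lbit τ (A j - δ j)
      - lbit τ (A j) - lbit τ 0)) MeasureTheory.volume (-R) R := by
    have := IntervalIntegrable.sum Finset.univ (fun h _ => i2 h)
    rw [Finset.sum_fn] at this
    exact this
  refine ⟨s1.sub s2, ?_⟩
  rw [intervalIntegral.integral_sub s1 s2,
    intervalIntegral.integral_finsetSum (fun h _ => i1 h),
    intervalIntegral.integral_finsetSum (fun h _ => i2 h)]
  congr 1
  · refine Finset.sum_congr rfl fun h _ => ?_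
    rw [intervalIntegral.integral_sub (lbit_integrable _ _ _) (lbit_integrable _ _ _), z,
      lbit_integral _ _ (abs_le.mp (hl h)).1 (abs_le.mp (hl h)).2]
    ring
  · refine Finset.sum_congr rfl fun j _ => ?_
    rw [intervalIntegral.integral_sub
        (((lbit_integrable _ _ _).add (lbit_integrable _ _ _)).sub (lbit_integrable _ _ _))
        (lbit_integrable _ _ _),
      intervalIntegral.integral_sub
        ((lbit_integrable _ _ _).add (lbit_integrable _ _ _)) (lbit_integrable _ _ _),
      intervalIntegral.integral_add (lbit_integrable _ _ _) (lbit_integrable _ _ _), z,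
      lbit_integral _ _ (abs_le.mp (hA j)).1 (abs_le.mp (hA j)).2,
      lbit_integral _ _ (abs_le.mp (hu j)).1 (abs_le.mp (hu j)).2,
      lbit_integral _ _ (abs_le.mp (hv j)).1 (abs_le.mp (hv j)).2]
    ring

theorem d_tightness
    {J M : Type*} [Fintype J] [Fintype M] [DecidableEq J] [DecidableEq M]
    (G1 G2 : Finset M) (hG1ne : G1.Nonempty) (hG2ne : G2.Nonempty)
    (hdisj : Disjoint G1 G2) (hcover : G1 ∪ G2 = Finset.univ)
    (b : J → M → ℕ) (a1 a2 : J → ℕ)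
    (ystar : J → M → ℝ) (x1star x2star : J → ℝ) (rstar wstar : ℝ)
    (hstar : FeasibleS G1 G2 b a1 a2 ystar x1star x2star rstar wstar)
    (hstaropt : ∀ y' x1' x2' r' w', FeasibleS G1 G2 b a1 a2 y' x1' x2' r' w' →
      wstar - rstar ≤ w' - r')
    (y : J → M → ℝ) (x1 x2 : J → ℝ) (r w : ℝ)
    (hfeas : FeasibleLP G1 G2 b a1 a2 rstar wstar y x1 x2 r w)
    (hopt : ∀ y' x1' x2' r' w',
      FeasibleLP G1 G2 b a1 a2 rstar wstar y' x1' x2' r' w' → r ≤ r')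
    (ε : ℝ) (hε0 : 0 < ε) (hε1 : ε < 1) (hrε : r = (⌊rstar⌋ : ℝ) + ε)
    (hsat1 : ∀ h ∈ G1, ((∑ j, y j h) = w) ∧
      (w = (∑ j, (b j h : ℝ)) - ((∑ j, (a2 j : ℝ)) - r)))
    (hsat2 : ∀ h ∈ G2, ((∑ j, y j h) = w) ∧
      (w = (∑ j, (b j h : ℝ)) - ((∑ j, (a1 j : ℝ)) - r)))
    (B1 B2 : Finset J)
    (hB1 : ∀ j, j ∈ B1 ↔ ¬∃ z : ℤ, x1 j = (z : ℝ))
    (hB2 : ∀ j, j ∈ B2 ↔ ¬∃ z : ℤ, x2 j = (z : ℝ))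
    :
    ∀ j ∈ B1 ∪ B2, (∑ h, y j h) = w := by
  exfalso
  obtain ⟨⟨f1, f2, f3, f4, f5, f6, f7, f8, f9, f10, f11⟩, hwr, hfl⟩ := hfeas
  set D : ℤ := ⌈wstar - rstar⌉ with hD
  have hw : w = r + D := by linarith
  subst hw
  set c1 : J → ℤ := fun j => (∑ h ∈ G1, (b j h : ℤ)) + a2 j - ∑ j, (a2 j : ℤ) with hc1
  set c2 : J → ℤ := fun j => (∑ h ∈ G2, (b j h : ℤ)) + a1 j - ∑ j, (a1 j : ℤ) with hc2
  have hc1' : ∀ j, (c1 j : ℝ) = (∑ h ∈ G1, (b j h : ℝ)) + a2 j - ∑ j, (a2 j : ℝ) := by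
    intro j; simp only [hc1]; push_cast; rfl
  have hc2' : ∀ j, (c2 j : ℝ) = (∑ h ∈ G2, (b j h : ℝ)) + a1 j - ∑ j, (a1 j : ℝ) := by
    intro j; simp only [hc2]; push_cast; rfl
  have hcol : ∀ h, ∑ j, y j h = r + D := by
    intro h
    have : h ∈ G1 ∪ G2 := by rw [hcover]; exact Finset.mem_univ h
    rcases Finset.mem_union.mp this with hh | hh
    · exact (hsat1 h hh).1
    · exact (hsat2 h hh).1
  have hC : ∀ j, r + c1 j ≤ ∑ h ∈ G1, y j h + x2 j := by
    intro j
    have := f10 j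
    rw [Finset.sum_sub_distrib] at this
    linarith [hc1' j]
  have hDd : ∀ j, r + c2 j ≤ ∑ h ∈ G2, y j h + x1 j := by
    intro j
    have := f11 j
    rw [Finset.sum_sub_distrib] at this
    linarith [hc2' j]
  have hE : ∀ j, r + c1 j + c2 j ≤ ∑ h, y j h := by
    intro j
    rw [sum_cover hdisj hcover]
    linarith [hC j, hDd j, f7 j]
  have hw0 : 0 ≤ r + D := by
    obtain ⟨h, -⟩ := hG1ne
    rw [← hcol h]
    exact Finset.sum_nonneg fun j _ => (f4 j h).1
  have hwpos : 0 < r + D := by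
    refine lt_of_le_of_ne hw0 fun h0 => ?_
    have h1 : ((-1 : ℤ) : ℝ) < ((⌊rstar⌋ + D : ℤ) : ℝ) := by push_cast; linarith
    have h2 : ((⌊rstar⌋ + D : ℤ) : ℝ) < ((0 : ℤ) : ℝ) := by push_cast; linarith
    have h3 := Int.cast_lt.mp h1
    have h4 := Int.cast_lt.mp h2
    omega
  obtain ⟨A, γ, δ, lam, m1, m2, hγ, hδ, hm1, hm2, tA, tE, tC, tD, ub1, u01, ub2, u02, hx1m, hx2m,
    hnorm⟩ := dual_exists G1 G2 hdisj (fun j => ∑ h, y j h = r + D)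
    (fun j => ∑ h, y j h = r + c1 j + c2 j) (fun j => ∑ h ∈ G1, y j h + x2 j = r + c1 j)
    (fun j => ∑ h ∈ G2, y j h + x1 j = r + c2 j) (fun j h => y j h = 0) (fun j h => y j h = b j h)
    (fun j => x1 j = 0) (fun j => x1 j = a1 j) (fun j => x2 j = 0) (fun j => x2 j = a2 j)
    (no_direction G1 G2 hdisj hcover b a1 a2 rstar wstar D rfl
      (fun h hh => by linarith [(hsat1 h hh).2]) (fun h hh => by linarith [(hsat2 h hh).2])
      (fun j => c1 j) (fun j => c2 j) hc1' hc2' y x1 x2 r hcol f3 hE hC hDd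
      (fun j h => (f4 j h).1) (fun j h => (f4 j h).2) (fun j => (f8 j).1) (fun j => (f8 j).2)
      (fun j => (f9 j).1) (fun j => (f9 j).2) f5 f6 (by linarith) hopt)
  have hB1m : ∀ j ∈ B1, δ j = m1 := fun j hj => hx1m j
    (fun h => (hB1 j).mp hj ⟨0, by simpa using h⟩)
    (fun h => (hB1 j).mp hj ⟨a1 j, by simpa using h⟩)
  have hB2m : ∀ j ∈ B2, γ j = m2 := fun j hj => hx2m j
    (fun h => (hB2 j).mp hj ⟨0, by simpa using h⟩)
    (fun h => (hB2 j).mp hj ⟨a2 j, by simpa using h⟩)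
  -- pointwise inequality
  set P : ℝ → ℝ := fun σ => saw ε (cum B2 x2 A σ) with hP
  set Q : ℝ → ℝ := fun σ => saw ε (cum B1 x1 A σ) with hQ
  have hpt : ∀ τ, (P (τ + m2) - P τ) + (Q (τ + m1) - Q τ) ≤ (lev A γ δ lam τ : ℝ) := by
    intro τ
    have s2 := cum_shift B2 x2 A γ m2 τ hB2m
    have s1 := cum_shift B1 x1 A δ m1 τ hB1m
    rcases level_dichotomy G1 G2 hdisj hcover b D ⌊rstar⌋ c1 c2 y x1 x2 r ε hrε hwpos hcol f3 hE
      (fun j h => (f4 j h).1) A γ δ lam hγ hδ tA tE tC tD ub1 u01 ub2 u02 τ with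
      ⟨h0, hz2, hz1⟩ | ⟨h1, k, hk⟩
    · have e2 : cum B2 x2 A (τ + m2) = cum B2 x2 A τ := by
        rw [← sub_eq_zero, s2]
        refine Finset.sum_eq_zero fun j hj => ?_
        rw [hz2 j ((hB2 j).mp hj)]; simp
      have e1 : cum B1 x1 A (τ + m1) = cum B1 x1 A τ := by
        rw [← sub_eq_zero, s1]
        refine Finset.sum_eq_zero fun j hj => ?_
        rw [hz1 j ((hB1 j).mp hj)]; simp
      simp only [hP, hQ, e1, e2, h0]
      simp
    · obtain ⟨k2, hk2⟩ := split_int B2 x2 hB2 (fun j => lbit τ (A j) - lbit τ (A j - γ j))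
      obtain ⟨k1, hk1⟩ := split_int B1 x1 hB1 (fun j => lbit τ (A j) - lbit τ (A j - δ j))
      refine saw_step hε0 hε1 _ _ _ _ _ (k - k1 - k2) h1 ?_
      rw [s1, s2]
      push_cast at hk hk1 hk2 ⊢
      linarith
  -- integration
  set S : ℝ := ∑ j, |A j| with hS
  have hSA : ∀ j, |A j| ≤ S := fun j =>
    Finset.single_le_sum (f := fun j => |A j|) (fun j _ => abs_nonneg _) (Finset.mem_univ j)
  set R : ℝ := (S + 1) + m1 + m2 + ∑ j, |A j - γ j| + ∑ j, |A j - δ j| + ∑ h, |lam h| with hR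
  have n1 : 0 ≤ S := Finset.sum_nonneg fun j _ => abs_nonneg _
  have n2 : 0 ≤ ∑ j, |A j - γ j| := Finset.sum_nonneg fun j _ => abs_nonneg _
  have n3 : 0 ≤ ∑ j, |A j - δ j| := Finset.sum_nonneg fun j _ => abs_nonneg _
  have n4 : 0 ≤ ∑ h, |lam h| := Finset.sum_nonneg fun j _ => abs_nonneg _
  obtain ⟨gi, gint⟩ := lev_integral A γ δ lam R (by linarith)
    (fun j => by linarith [hSA j])
    (fun j => by
      have := Finset.single_le_sum (f := fun j => |A j - γ j|) (fun j _ => abs_nonneg _)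
        (Finset.mem_univ j)
      linarith)
    (fun j => by
      have := Finset.single_le_sum (f := fun j => |A j - δ j|) (fun j _ => abs_nonneg _)
        (Finset.mem_univ j)
      linarith)
    (fun j => by
      have := Finset.single_le_sum (f := fun j => |lam j|) (fun j _ => abs_nonneg _)
        (Finset.mem_univ j)
      linarith)
  have key : ∀ (B : Finset J) (x : J → ℝ), (∀ j, j ∈ B ↔ ¬∃ z : ℤ, x j = (z : ℝ)) →
      ∑ j, x j = r → (∀ t, t ≤ -(S + 1) → saw ε (cum B x A t) = 0) ∧
      (∀ t, S + 1 ≤ t → saw ε (cum B x A t) = 1) := by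
    intro B x hB hx
    constructor
    · intro t ht
      have : cum B x A t = 0 := by
        unfold cum
        refine Finset.sum_eq_zero fun j _ => ?_
        rw [if_neg, mul_zero]
        have := (abs_le.mp (hSA j)).1
        push Not; linarith
      rw [this, saw_zero hε1]
    · intro t ht
      have h1 : cum B x A t = ∑ j ∈ B, x j := by
        unfold cum
        refine Finset.sum_congr rfl fun j _ => ?_
        rw [if_pos, mul_one]
        have := (abs_le.mp (hSA j)).2
        linarith
      obtain ⟨k, hk⟩ := split_int B x hB (fun _ => 1)
      simp only [Int.cast_one, one_mul] at hk
      have h2 : cum B x A t = ε + ((⌊rstar⌋ - k : ℤ) : ℝ) := by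
        rw [h1]; push_cast; linarith
      rw [h2, saw_add_int, saw_eps hε0 hε1]
  obtain ⟨lP, uP⟩ := key B2 x2 hB2 f6
  obtain ⟨lQ, uQ⟩ := key B1 x1 hB1 f5
  have mP : Measurable P := (saw_measurable ε).comp (cum_measurable B2 x2 A)
  have mQ : Measurable Q := (saw_measurable ε).comp (cum_measurable B1 x1 A)
  have P0 : ∀ t, 0 ≤ P t := fun t => saw_nonneg hε0 hε1 _
  have P1 : ∀ t, P t ≤ 1 := fun t => saw_le_one hε0 hε1 _
  have Q0 : ∀ t, 0 ≤ Q t := fun t => saw_nonneg hε0 hε1 _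
  have Q1 : ∀ t, Q t ≤ 1 := fun t => saw_le_one hε0 hε1 _
  have IP := shift_integral P mP P0 P1 (S + 1) R m2 hm2 (by linarith) lP uP
  have IQ := shift_integral Q mQ Q0 Q1 (S + 1) R m1 hm1 (by linarith) lQ uQ
  have iP : IntervalIntegrable (fun t => P (t + m2) - P t) MeasureTheory.volume (-R) R :=
    (bdd_integrable _ (mP.comp (measurable_id.add_const m2)) (fun t => P0 _) (fun t => P1 _) _ _).sub
      (bdd_integrable P mP P0 P1 _ _)
  have iQ : IntervalIntegrable (fun t => Q (t + m1) - Q t) MeasureTheory.volume (-R) R :=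
    (bdd_integrable _ (mQ.comp (measurable_id.add_const m1)) (fun t => Q0 _) (fun t => Q1 _) _ _).sub
      (bdd_integrable Q mQ Q0 Q1 _ _)
  have hmono := intervalIntegral.integral_mono_on (by linarith : -R ≤ R) (iP.add iQ) gi
    (fun t _ => hpt t)
  rw [gint] at hmono
  have hadd := intervalIntegral.integral_add iP iQ
  rw [IP, IQ] at hadd
  have hmono' : m2 + m1 ≤ ∑ h, lam h - ∑ j, (A j - γ j - δ j) := by
    rw [← hadd]; exact hmono
  simp only [Finset.sum_sub_distrib] at hmono'
  linarith
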